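/- Three distinct collinear complex numbers z1, z2, z3 with z1+z2+z3=0 have real j-invariant j(z1,z2,z3) ≥ 1; moreover j = 1 if and only if one of the points is the midpoint of the other two (the two segments from the middle point have equal length). -/

import Mathlib

/-- Collinear complex numbers with sum zero are real multiples of a common vector. -/
lemma Collinear.exists_real_mul_of_sum_eq_zero {z1 z2 z3 : ℂ}
    (hcol : Collinear ℝ ({z1, z2, z3} : Set ℂ)) (hsum : z1 + z2 + z3 = 0) :
    ∃ (v : ℂ) (a b c : ℝ), a + b + c = 0 ∧ z1 = a * v ∧ z2 = b * v ∧ z3 = c * v := by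
  obtain ⟨v, hv⟩ := (collinear_iff_of_mem (p₀ := z1) (by simp)).1 hcol
  obtain ⟨r, hr⟩ := hv z2 (by simp)
  obtain ⟨s, hs⟩ := hv z3 (by simp)
  simp only [vadd_eq_add, Complex.real_smul] at hr hs
  have h1 : z1 = (-(r + s) / 3) * v := by linear_combination (hsum - hr - hs) / 3
  refine ⟨v, -(r + s) / 3, (2 * r - s) / 3, (2 * s - r) / 3, by ring, ?_, ?_, ?_⟩
  · push_cast
    exact h1
  · push_cast
    linear_combination hr + h1
  · push_cast
    linear_combination hs + h1

/-- The discriminant of a depressed cubic in terms of its roots. -/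
lemma depressed_cubic_discr {R : Type*} [CommRing R] {a b c : R} (h : a + b + c = 0) :
    -4 * (a * b + a * c + b * c) ^ 3 - 27 * (-(a * b * c)) ^ 2 =
      ((a - b) * (a - c) * (b - c)) ^ 2 := by
  obtain rfl : c = -a - b := by linear_combination h
  ring

/-- Three distinct collinear complex numbers summing to zero have real `j`-invariant
`≥ 1`, with `j = 1` iff one of the points is the midpoint of the other two. -/
theorem jInvariant_collinear (z1 z2 z3 : ℂ)
    (h12 : z1 ≠ z2) (h13 : z1 ≠ z3) (h23 : z2 ≠ z3)
    (hsum : z1 + z2 + z3 = 0)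
    (hcol : Collinear ℝ ({z1, z2, z3} : Set ℂ)) :
    let g2 : ℂ := z1 * z2 + z1 * z3 + z2 * z3
    let g3 : ℂ := -(z1 * z2 * z3)
    let j : ℂ := -4 * g2 ^ 3 / (-4 * g2 ^ 3 - 27 * g3 ^ 2)
    j.im = 0 ∧ 1 ≤ j.re ∧
      (j = 1 ↔ (z1 = (z2 + z3) / 2 ∨ z2 = (z1 + z3) / 2 ∨ z3 = (z1 + z2) / 2)) := by
  intro g2 g3 j
  have hD : -4 * g2 ^ 3 - 27 * g3 ^ 2 ≠ 0 := by
    rw [depressed_cubic_discr hsum]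
    exact pow_ne_zero 2 (mul_ne_zero (mul_ne_zero (sub_ne_zero.2 h12) (sub_ne_zero.2 h13))
      (sub_ne_zero.2 h23))
  have hj : j = 1 + 27 * g3 ^ 2 / (-4 * g2 ^ 3 - 27 * g3 ^ 2) := by
    simp only [j]
    rw [← div_self hD, ← add_div, sub_add_cancel]
  have hreal : ∃ t : ℝ, 0 ≤ t ∧ j = ((1 + t : ℝ) : ℂ) := by
    obtain ⟨v, a, b, c, -, ha, hb, hc⟩ := hcol.exists_real_mul_of_sum_eq_zero hsum
    have hv : v ≠ 0 := by
      rintro rfl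
      simp [ha, hb] at h12
    refine ⟨27 * (a * b * c) ^ 2 / ((a - b) * (a - c) * (b - c)) ^ 2, by positivity, ?_⟩
    rw [hj, depressed_cubic_discr hsum]
    have hnum : 27 * g3 ^ 2 = v ^ 6 * (27 * (a * b * c) ^ 2) := by
      simp only [g3, ha, hb, hc]
      ring
    have hden : ((z1 - z2) * (z1 - z3) * (z2 - z3)) ^ 2 =
        v ^ 6 * ((a - b) * (a - c) * (b - c)) ^ 2 := by
      rw [ha, hb, hc]
      ring
    rw [hnum, hden, mul_div_mul_left _ _ (pow_ne_zero 6 hv)]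
    push_cast
    rfl
  obtain ⟨t, ht, hjt⟩ := hreal
  refine ⟨by rw [hjt, Complex.ofReal_im], by rw [hjt, Complex.ofReal_re]; linarith, ?_⟩
  have h1 : z1 = (z2 + z3) / 2 ↔ z1 = 0 := by
    constructor <;> intro h
    · linear_combination (2 * h + hsum) / 3
    · linear_combination (3 * h - hsum) / 2
  have h2 : z2 = (z1 + z3) / 2 ↔ z2 = 0 := by
    constructor <;> intro h
    · linear_combination (2 * h + hsum) / 3
    · linear_combination (3 * h - hsum) / 2
  have h3 : z3 = (z1 + z2) / 2 ↔ z3 = 0 := by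
    constructor <;> intro h
    · linear_combination (2 * h + hsum) / 3
    · linear_combination (3 * h - hsum) / 2
  rw [h1, h2, h3, hj, add_eq_left, div_eq_zero_iff, or_iff_left hD]
  simp [g3, or_assoc]
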